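/- Let g = s ⊕ m₁ ⊕ ... ⊕ m_t be a Lie algebra obtained from the chain construction (s simple, m_i irreducible s-modules with ρ₁ faithful, bracket on modules given by s-module homomorphisms p_{ijk} with p_{1j(j+1)} ≠ 0). Then g is a perfect Lie algebra (g = [g,g]), the subspace n = m₁ ⊕ ... ⊕ m_t is a nilpotent ideal whose k-th lower central series term is n^k = m_k ⊕ m_{k+1} ⊕ ... ⊕ m_t, and n is the unique maximal proper ideal of g. -/

import Mathlib

/-- A (bilinear) Lie bracket on a `K`-module. -/
structure IsLieBracket (K : Type*) [CommRing K] (M : Type*) [AddCommGroup M] [Module K M]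
    (br : M → M → M) : Prop where
  add_left : ∀ x y z : M, br (x + y) z = br x z + br y z
  smul_left : ∀ (c : K) (x y : M), br (c • x) y = c • br x y
  skew : ∀ x y : M, br x y = - br y x
  jacobi : ∀ x y z : M, br (br x y) z + br (br z x) y + br (br y z) x = 0

/-- A submodule is an ideal for a bracket if it absorbs the bracket. -/
def IsBrIdeal (K : Type*) [CommRing K] {M : Type*} [AddCommGroup M] [Module K M]
    (br : M → M → M) (S : Submodule K M) : Prop :=
  ∀ x : M, ∀ s ∈ S, br x s ∈ S

/-- The submodule `m_k ⊕ m_{k+1} ⊕ ⋯ ⊕ m_t` of `s × (m₁ × ⋯ × m_t)`. -/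
def tailT (K : Type*) [Field K] (s : Type*) [AddCommGroup s] [Module K s]
    (t : ℕ) (m : ℕ → Type*) [∀ i, AddCommGroup (m i)] [∀ i, Module K (m i)] (k : ℕ) :
    Submodule K (s × ((i : Fin t) → m (i.1 + 1))) :=
  (⊥ : Submodule K s).prod
    (Submodule.pi Set.univ (fun i : Fin t =>
      if k ≤ i.1 + 1 then (⊤ : Submodule K (m (i.1 + 1))) else ⊥))

theorem IsLieBracket.add_right {K M : Type*} [CommRing K] [AddCommGroup M] [Module K M]
    {br : M → M → M} (h : IsLieBracket K M br) (x y z : M) :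
    br x (y + z) = br x y + br x z := by
  rw [h.skew, h.add_left, neg_add, ← h.skew, ← h.skew]

theorem IsLieBracket.smul_right {K M : Type*} [CommRing K] [AddCommGroup M] [Module K M]
    {br : M → M → M} (h : IsLieBracket K M br) (c : K) (x y : M) :
    br x (c • y) = c • br x y := by
  rw [h.skew, h.smul_left, ← smul_neg, ← h.skew]

/-- A Lie bracket as a bilinear map. -/
def IsLieBracket.toLinearMap {K M : Type*} [CommRing K] [AddCommGroup M] [Module K M]
    {br : M → M → M} (h : IsLieBracket K M br) : M →ₗ[K] M →ₗ[K] M :=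
  LinearMap.mk₂ K br h.add_left h.smul_left h.add_right h.smul_right

theorem Submodule.span_eq_top_of_irreducible {K A V : Type*} [Field K] [AddCommGroup V]
    [Module K V] (ρ : A → V →ₗ[K] V)
    (hirr : ∀ W : Submodule K V, (∀ x, ∀ w ∈ W, ρ x w ∈ W) → W = ⊥ ∨ W = ⊤)
    (T : Set V) (hT : ∀ x, ∀ w ∈ T, ρ x w ∈ Submodule.span K T) (hne : ∃ w ∈ T, w ≠ 0) :
    Submodule.span K T = ⊤ := by
  obtain ⟨w, hw, hw0⟩ := hne
  refine (hirr _ fun x => ?_).resolve_left fun h => hw0 ?_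
  · exact (Submodule.span_le (p := (Submodule.span K T).comap (ρ x))).2 (hT x)
  · simpa [h] using Submodule.subset_span (R := K) hw

theorem LieAlgebra.span_lie_eq_top_of_isSimple {K s : Type*} [Field K] [LieRing s]
    [LieAlgebra K s] (h : LieAlgebra.IsSimple K s) :
    Submodule.span K {z : s | ∃ x y : s, z = ⁅x, y⁆} = ⊤ := by
  refine Submodule.span_eq_top_of_irreducible (fun x : s => (LieAlgebra.ad K s x : s →ₗ[K] s))
    (fun W hW => ?_) _ (fun x w _ => Submodule.subset_span ⟨x, w, rfl⟩) ?_
  · exact (h.eq_bot_or_eq_top { W with lie_mem := fun {x w} hw => hW x w hw }).imp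
      (fun e => congrArg LieSubmodule.toSubmodule e) (fun e => congrArg LieSubmodule.toSubmodule e)
  · by_contra! hc
    exact h.non_abelian ⟨fun x y => hc _ ⟨x, y, rfl⟩⟩

section tail

variable {K : Type*} [Field K] {s : Type*} [AddCommGroup s] [Module K s]
  {t : ℕ} {m : ℕ → Type*} [∀ i, AddCommGroup (m i)] [∀ i, Module K (m i)]

theorem mem_tailT {k : ℕ} {z : s × ((i : Fin t) → m (i.1 + 1))} :
    z ∈ tailT K s t m k ↔ z.1 = 0 ∧ ∀ i : Fin t, i.1 + 1 < k → z.2 i = 0 := by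
  simp only [tailT, Submodule.mem_prod, Submodule.mem_bot, Submodule.mem_pi, Set.mem_univ,
    true_imp_iff]
  refine and_congr_right fun _ => forall_congr' fun i => ?_
  split_ifs with h
  · simp [h]
  · simp [not_le.1 h]

theorem tailT_last_succ : tailT K s t m (t + 1) = ⊥ := by
  refine (Submodule.eq_bot_iff _).2 fun z hz => ?_
  obtain ⟨h1, h2⟩ := mem_tailT.1 hz
  exact Prod.ext h1 (funext fun i => h2 i (by omega))

theorem tailT_anti {k l : ℕ} (h : k ≤ l) : tailT K s t m l ≤ tailT K s t m k := fun _ hz =>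
  mem_tailT.2 ⟨(mem_tailT.1 hz).1, fun i hi => (mem_tailT.1 hz).2 i (hi.trans_le h)⟩

theorem single_mem_tailT (i : Fin t) (u : m (i.1 + 1)) :
    ((0, Pi.single i u) : s × ((i : Fin t) → m (i.1 + 1))) ∈ tailT K s t m (i.1 + 1) := by
  refine mem_tailT.2 ⟨rfl, fun l hl => Pi.single_eq_of_ne (fun e => ?_) _⟩
  subst e
  omega

variable (K s m) in
/-- The inclusion of the summand with index `i` in `s × (m₁ × ⋯ × m_t)`. -/
def summandInclusion (i : Fin t) : m (i.1 + 1) →ₗ[K] s × ((i : Fin t) → m (i.1 + 1)) :=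
  LinearMap.inr K s _ ∘ₗ LinearMap.single K (fun i : Fin t => m (i.1 + 1)) i

theorem summandInclusion_apply (i : Fin t) (u : m (i.1 + 1)) :
    summandInclusion K s m i u = (0, Pi.single i u) := rfl

theorem sum_summandInclusion (f : (i : Fin t) → m (i.1 + 1)) :
    ∑ i, summandInclusion K s m i (f i) = (0, f) := by
  simp only [summandInclusion, LinearMap.comp_apply, ← map_sum, LinearMap.single_apply,
    Finset.univ_sum_single]
  rfl

/-- Downward induction on the filtration by the submodules `tailT`. -/
theorem tailT_le_of_single_mem {W : Submodule K (s × ((i : Fin t) → m (i.1 + 1)))} {k : ℕ}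
    (h : ∀ j : Fin t, k ≤ j.1 + 1 → tailT K s t m (j.1 + 2) ≤ W →
      ∀ u, summandInclusion K s m j u ∈ W) :
    k ≤ t + 1 → tailT K s t m k ≤ W := by
  intro hk
  induction hk using Nat.decreasingInduction with
  | self => simp [tailT_last_succ]
  | of_succ k hk ih =>
    have hsucc := ih fun j hj => h j (by omega)
    intro z hz
    obtain ⟨h1, h2⟩ := mem_tailT.1 hz
    rcases k with _ | k
    · exact hsucc (mem_tailT.2 ⟨h1, fun i hi => by omega⟩)
    · let j : Fin t := ⟨k, by omega⟩
      have hmem := h j le_rfl hsucc (z.2 j)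
      rw [← sub_add_cancel z (summandInclusion K s m j (z.2 j))]
      refine W.add_mem (hsucc (mem_tailT.2 ⟨?_, fun i hi => ?_⟩)) hmem
      · simp [summandInclusion_apply, h1]
      · rcases eq_or_ne i j with rfl | hij
        · simp [summandInclusion_apply]
        · have : i.1 ≠ k := fun e => hij (Fin.ext e)
          simp [summandInclusion_apply, Pi.single_eq_of_ne hij, h2 i (by omega)]

end tail

/-- The bracket of `n` with `m_k ⊕ ⋯ ⊕ m_t` lies in `m_{k+1} ⊕ ⋯ ⊕ m_t`. -/
theorem bracket_mem_tailT_succ {K : Type*} [Field K] {s : Type*} [AddCommGroup s] [Module K s]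
    {t : ℕ} {m : ℕ → Type*} [∀ i, AddCommGroup (m i)] [∀ i, Module K (m i)]
    {br : (s × ((i : Fin t) → m (i.1 + 1))) → (s × ((i : Fin t) → m (i.1 + 1))) →
      (s × ((i : Fin t) → m (i.1 + 1)))}
    (hbr : IsLieBracket K _ br)
    (p : (i j k : ℕ) → m i →ₗ[K] m j →ₗ[K] m k)
    (hbr_mod : ∀ i j : Fin t, i ≤ j → ∀ (u : m (i.1 + 1)) (v : m (j.1 + 1)),
      br (0, Pi.single i u) (0, Pi.single j v) =
        (0, fun k : Fin t =>
          if i.1 + j.1 + 1 ≤ k.1 then p (i.1 + 1) (j.1 + 1) (k.1 + 1) u v else 0))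
    {k : ℕ} {x y : s × ((i : Fin t) → m (i.1 + 1))}
    (hx : x.1 = 0) (hy : y ∈ tailT K s t m k) : br x y ∈ tailT K s t m (k + 1) := by
  have hle (i j : Fin t) (hij : i ≤ j) (u : m (i.1 + 1)) (v : m (j.1 + 1)) :
      br (0, Pi.single i u) (0, Pi.single j v) ∈ tailT K s t m (i.1 + j.1 + 2) := by
    rw [hbr_mod i j hij]
    exact mem_tailT.2 ⟨rfl, fun l hl => if_neg (by omega)⟩
  have hsingle (i j : Fin t) (u : m (i.1 + 1)) (v : m (j.1 + 1)) :
      br (0, Pi.single i u) (0, Pi.single j v) ∈ tailT K s t m (j.1 + 2) := by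
    rcases le_total i j with hij | hij
    · exact tailT_anti (by omega) (hle i j hij u v)
    · rw [hbr.skew]
      exact neg_mem (tailT_anti (by omega) (hle j i hij v u))
  obtain ⟨a, f⟩ := x
  obtain ⟨b, g⟩ := y
  obtain ⟨h1, h2⟩ := mem_tailT.1 hy
  dsimp only at hx h1 h2
  subst hx h1
  change hbr.toLinearMap (0, f) (0, g) ∈ _
  rw [← sum_summandInclusion (K := K) f, ← sum_summandInclusion (K := K) g]
  simp only [map_sum, LinearMap.sum_apply]
  refine sum_mem fun j _ => sum_mem fun i _ => ?_
  by_cases hk : k ≤ j.1 + 1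
  · exact tailT_anti (by omega) (hsingle i j _ _)
  · simp [h2 j (by omega)]

/-- A Lie algebra `g = s ⊕ m₁ ⊕ ⋯ ⊕ m_t` obtained from the chain construction is perfect,
`n = m₁ ⊕ ⋯ ⊕ m_t` is a nilpotent ideal with lower central series `n^k = m_k ⊕ ⋯ ⊕ m_t`,
and `n` is the unique maximal proper ideal of `g`. -/
theorem chain_construction_perfect_nilradical
    (K : Type*) [Field K] [CharZero K]
    (s : Type*) [LieRing s] [LieAlgebra K s] [FiniteDimensional K s]
    (hsimple : LieAlgebra.IsSimple K s)
    (t : ℕ) (ht : 1 ≤ t)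
    (m : ℕ → Type*) [∀ i, AddCommGroup (m i)] [∀ i, Module K (m i)]
    [∀ i, FiniteDimensional K (m i)]
    (ρ : (i : ℕ) → s →ₗ[K] m i →ₗ[K] m i)
    (hρ : ∀ i (x y : s), ρ i ⁅x, y⁆ = ρ i x ∘ₗ ρ i y - ρ i y ∘ₗ ρ i x)
    (hfaithful : ∀ x : s, ρ 1 x = 0 → x = 0)
    (hirr : ∀ i, 1 ≤ i → i ≤ t →
      (∃ (x : s) (u : m i), ρ i x u ≠ 0) ∧
      (∀ W : Submodule K (m i), (∀ x : s, ∀ w ∈ W, ρ i x w ∈ W) → W = ⊥ ∨ W = ⊤))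
    (p : (i j k : ℕ) → m i →ₗ[K] m j →ₗ[K] m k)
    (hequiv : ∀ i j k, 1 ≤ i → i ≤ j → j ≤ k → k ≤ t → i + j ≤ k →
      ∀ (x : s) (u : m i) (v : m j),
        p i j k (ρ i x u) v + p i j k u (ρ j x v) = ρ k x (p i j k u v))
    (hskew : ∀ i k, 1 ≤ i → i + i ≤ k → k ≤ t →
      ∀ u v : m i, p i i k u v = - p i i k v u)
    (hnonzero : ∀ j, 1 ≤ j → j + 1 ≤ t → p 1 j (j + 1) ≠ 0)
    (br : (s × ((i : Fin t) → m (i.1 + 1))) → (s × ((i : Fin t) → m (i.1 + 1))) →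
      (s × ((i : Fin t) → m (i.1 + 1))))
    (hbr : IsLieBracket K _ br)
    (hbr_s : ∀ x y : s, br (x, 0) (y, 0) = (⁅x, y⁆, 0))
    (hbr_act : ∀ (x : s) (f : (i : Fin t) → m (i.1 + 1)),
      br (x, 0) (0, f) = (0, fun i => ρ (i.1 + 1) x (f i)))
    (hbr_mod : ∀ i j : Fin t, i ≤ j → ∀ (u : m (i.1 + 1)) (v : m (j.1 + 1)),
      br (0, Pi.single i u) (0, Pi.single j v) =
        (0, fun k : Fin t =>
          if i.1 + j.1 + 1 ≤ k.1 then p (i.1 + 1) (j.1 + 1) (k.1 + 1) u v else 0)) :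
    (Submodule.span K {z : s × ((i : Fin t) → m (i.1 + 1)) | ∃ x y, z = br x y} = ⊤) ∧
    IsBrIdeal K br (tailT K s t m 1) ∧
    (∀ N : ℕ → Submodule K (s × ((i : Fin t) → m (i.1 + 1))),
      N 1 = tailT K s t m 1 →
      (∀ k, 1 ≤ k → N (k + 1) =
        Submodule.span K {z | ∃ x ∈ tailT K s t m 1, ∃ y ∈ N k, z = br x y}) →
      ∀ k, 1 ≤ k → k ≤ t + 1 → N k = tailT K s t m k) ∧
    (tailT K s t m (t + 1) = ⊥) ∧
    (∀ S : Submodule K (s × ((i : Fin t) → m (i.1 + 1))),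
      IsBrIdeal K br S → S ≠ ⊤ → S ≤ tailT K s t m 1) := by
  have hmem {x y : s × ((i : Fin t) → m (i.1 + 1))} {k : ℕ} (hx : x.1 = 0)
      (hy : y ∈ tailT K s t m k) : br x y ∈ tailT K s t m (k + 1) :=
    bracket_mem_tailT_succ hbr p hbr_mod hx hy
  have hsplit (z : s × ((i : Fin t) → m (i.1 + 1))) : z = (z.1, 0) + (0, z.2) := by simp
  have hact (x : s) (i : Fin t) (u : m (i.1 + 1)) :
      br (x, 0) (summandInclusion K s m i u) = summandInclusion K s m i (ρ (i.1 + 1) x u) := by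
    rw [summandInclusion_apply, hbr_act, summandInclusion_apply]
    refine Prod.ext rfl (funext fun j => ?_)
    exact Pi.apply_single (fun (j : Fin t) => ρ (j.1 + 1) x) (fun j => map_zero _) i u j
  have hρspan (i : Fin t) :
      Submodule.span K {w : m (i.1 + 1) | ∃ x u, w = ρ (i.1 + 1) x u} = ⊤ := by
    obtain ⟨⟨x, u, hxu⟩, hW⟩ := hirr (i.1 + 1) (by omega) (by omega)
    exact Submodule.span_eq_top_of_irreducible _ hW _
      (fun x w _ => Submodule.subset_span ⟨x, w, rfl⟩) ⟨_, ⟨x, u, rfl⟩, hxu⟩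
  have hsummand (W : Submodule K (s × ((i : Fin t) → m (i.1 + 1)))) (i : Fin t)
      (T : Set (m (i.1 + 1))) (hT : Submodule.span K T = ⊤)
      (h : ∀ w ∈ T, summandInclusion K s m i w ∈ W) (u : m (i.1 + 1)) :
      summandInclusion K s m i u ∈ W := by
    have hle : Submodule.span K T ≤ W.comap (summandInclusion K s m i) := Submodule.span_le.2 h
    exact hle (hT ▸ Submodule.mem_top)
  have htop (W : Submodule K (s × ((i : Fin t) → m (i.1 + 1))))
      (h1 : ∀ x : s, ∃ f, (x, f) ∈ W) (h2 : tailT K s t m 1 ≤ W) : W = ⊤ := by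
    refine (Submodule.eq_top_iff').2 fun z => ?_
    obtain ⟨f, hf⟩ := h1 z.1
    have hz : z = (z.1, f) + (0, z.2 - f) := by simp
    rw [hz]
    exact W.add_mem hf (h2 (mem_tailT.2 ⟨rfl, fun i hi => by omega⟩))
  have hideal (k : ℕ) : ∀ z, ∀ y ∈ tailT K s t m k, br z y ∈ tailT K s t m k := by
    intro z y hy
    rw [hsplit z, hbr.add_left]
    refine add_mem ?_ (tailT_anti (Nat.le_succ k) (hmem rfl hy))
    obtain ⟨b, g⟩ := y
    obtain ⟨h1, h2⟩ := mem_tailT.1 hy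
    dsimp only at h1 h2
    subst h1
    rw [hbr_act]
    exact mem_tailT.2 ⟨rfl, fun i hi => by simp [h2 i hi]⟩
  refine ⟨?_, hideal 1, ?_, tailT_last_succ, ?_⟩
  · refine htop _ (fun x => ⟨0, ?_⟩) (tailT_le_of_single_mem (fun j _ _ => ?_) (by omega))
    · have hle : Submodule.span K {z : s | ∃ x y : s, z = ⁅x, y⁆} ≤
          (Submodule.span K {z | ∃ x y, z = br x y}).comap
            (LinearMap.inl K s ((i : Fin t) → m (i.1 + 1))) := by
        refine Submodule.span_le.2 ?_
        rintro _ ⟨x, y, rfl⟩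
        exact Submodule.subset_span ⟨_, _, (hbr_s x y).symm⟩
      exact hle (LieAlgebra.span_lie_eq_top_of_isSimple hsimple ▸ Submodule.mem_top)
    · refine hsummand _ j _ (hρspan j) ?_
      rintro _ ⟨x, u, rfl⟩
      exact Submodule.subset_span ⟨_, _, (hact x j u).symm⟩
  · intro N hN1 hN k hk
    induction k, hk using Nat.le_induction with
    | base => exact fun _ => hN1
    | succ k hk ih =>
      intro hkt
      rw [hN k hk, ih (by omega)]
      refine le_antisymm (Submodule.span_le.2 ?_)
        (tailT_le_of_single_mem (fun j hj hle => ?_) hkt)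
      · rintro _ ⟨x, hx, y, hy, rfl⟩
        exact hmem (mem_tailT.1 hx).1 hy
      · obtain ⟨j, hjt⟩ := j
        obtain ⟨j, rfl⟩ : ∃ l, j = l + 1 := ⟨j - 1, by simp at hj; omega⟩
        have hspan : Submodule.span K
            {w : m (j + 1 + 1) | ∃ u v, w = p 1 (j + 1) (j + 1 + 1) u v} = ⊤ := by
          refine Submodule.span_eq_top_of_irreducible _
            (hirr (j + 1 + 1) (by omega) (by omega)).2 _ ?_ ?_
          · rintro x _ ⟨u, v, rfl⟩
            rw [← hequiv 1 (j + 1) (j + 1 + 1) le_rfl (by omega) (by omega) (by omega)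
              (by omega)]
            exact add_mem (Submodule.subset_span ⟨_, _, rfl⟩)
              (Submodule.subset_span ⟨_, _, rfl⟩)
          · by_contra! hc
            exact hnonzero (j + 1) (by omega) (by omega)
              (LinearMap.ext₂ fun u v => hc _ ⟨u, v, rfl⟩)
        refine hsummand _ ⟨j + 1, hjt⟩ _ hspan ?_
        rintro _ ⟨u, v, rfl⟩
        let i₀ : Fin t := ⟨0, by omega⟩
        let j₀ : Fin t := ⟨j, by omega⟩
        have hbrk := hbr_mod i₀ j₀ (Nat.zero_le j) u v
        rw [← sub_sub_cancel (br (0, Pi.single i₀ u) (0, Pi.single j₀ v))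
          (summandInclusion K s m ⟨j + 1, hjt⟩ (p 1 (j + 1) (j + 1 + 1) u v))]
        refine sub_mem (Submodule.subset_span ⟨_, tailT_anti (by simp [i₀])
          (single_mem_tailT i₀ u), _, tailT_anti (by simp at hj; simp [j₀]; omega)
          (single_mem_tailT j₀ v), rfl⟩) (hle ?_)
        rw [hbrk, summandInclusion_apply]
        refine mem_tailT.2 ⟨by simp, fun l hl => ?_⟩
        rcases eq_or_ne l ⟨j + 1, hjt⟩ with rfl | hne
        · simp [i₀, j₀]
        · have : l.1 ≠ j + 1 := fun e => hne (Fin.ext e)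
          have hlt : ¬ (i₀.1 + j₀.1 < l.1) := by
            simp only [i₀, j₀] at hl ⊢
            omega
          simp [hlt, Pi.single_eq_of_ne hne]
  · intro S hS hne
    have hfst : ∀ x w : s, w ∈ S.map (LinearMap.fst K s _) →
        ⁅x, w⁆ ∈ S.map (LinearMap.fst K s _) := by
      rintro x _ ⟨⟨a, f⟩, ha, rfl⟩
      refine ⟨_, hS (x, 0) _ ha, ?_⟩
      rw [hsplit (a, f), hbr.add_right, hbr_s, hbr_act]
      simp
    rcases hsimple.eq_bot_or_eq_top
      { S.map (LinearMap.fst K s _) with lie_mem := fun {x w} hw => hfst x w hw } with h | h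
    · have hbot : S.map (LinearMap.fst K s _) = ⊥ := congrArg LieSubmodule.toSubmodule h
      intro z hz
      refine mem_tailT.2 ⟨?_, fun i hi => by omega⟩
      have : z.1 ∈ S.map (LinearMap.fst K s _) := ⟨z, hz, rfl⟩
      simpa [hbot] using this
    · have hmap : S.map (LinearMap.fst K s _) = ⊤ := congrArg LieSubmodule.toSubmodule h
      have hex (x : s) : ∃ f, (x, f) ∈ S := by
        have hx : x ∈ S.map (LinearMap.fst K s _) := hmap ▸ Submodule.mem_top
        obtain ⟨⟨a, f⟩, ha, rfl⟩ := hx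
        exact ⟨f, ha⟩
      refine absurd (htop S hex (tailT_le_of_single_mem (fun j _ hle => ?_) (by omega))) hne
      refine hsummand S j _ (hρspan j) ?_
      rintro _ ⟨x, u, rfl⟩
      obtain ⟨f, hf⟩ := hex x
      have hbrS : br (x, f) (summandInclusion K s m j u) ∈ S := by
        rw [hbr.skew]
        exact neg_mem (hS _ _ hf)
      rw [hsplit (x, f), hbr.add_left, hact] at hbrS
      exact (Submodule.add_mem_iff_left S (hle (hmem rfl (single_mem_tailT j u)))).1 hbrS
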